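/- arXiv:1503.02587 — 4 statements merged into one kernel-verified Lean document; each statement's English description precedes it below -/
import Mathlib

section
/- Let (X, τ) be a topological space, let δ be a Lodato proximity on X compatible with τ, and suppose that for every closed set F ⊆ X and every point x ∉ F, the singleton {x} is strongly far from F. Let 𝔅 be a nonempty family of nonempty closed subsets of X. Equip CL(X) with the hit and strongly far-miss topology τ⩔,𝔅 generated by the subbase consisting of all sets V⁻ = {E ∈ CL(X) : E ∩ V ≠ ∅} with V open in X, together with all sets A⩔ = {E ∈ CL(X) : E is strongly far from X \ A} with A open in X and X \ A ∈ 𝔅. Then (CL(X), τ⩔,𝔅) is Hausdorff (T2) if and only if Σ(𝔅) is a strongly local family, i.e., for every x ∈ X and every open set U containing x there exists S ∈ Σ(𝔅) with x ∈ interior(S) and S strongly far from X \ U. -/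
/-- `A` is strongly far from `B` (with respect to the proximity `δ`). -/
def StronglyFar {X : Type*} (δ : Set X → Set X → Prop) (A B : Set X) : Prop :=
  ¬ δ A B ∧ ∃ C : Set X, ¬ δ A Cᶜ ∧ ¬ δ C B

/-- `CL(X)`: the nonempty closed subsets of `X`. -/
def CLSpace (X : Type*) [TopologicalSpace X] : Type _ :=
  {E : Set X // IsClosed E ∧ E.Nonempty}

/-- The subbase of the hit and strongly far-miss topology `τ⩔,𝔅` on `CL(X)`:
hit sets `V⁻` for `V` open, and miss sets `A⩔` for `A` open with `X \ A ∈ 𝔅`. -/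
def hitStronglyFarMissSubbase {X : Type*} [TopologicalSpace X]
    (δ : Set X → Set X → Prop) (B : Set (Set X)) : Set (Set (CLSpace X)) :=
  {s | ∃ V : Set X, IsOpen V ∧ s = {E : CLSpace X | (E.1 ∩ V).Nonempty}} ∪
  {s | ∃ A : Set X, IsOpen A ∧ Aᶜ ∈ B ∧ s = {E : CLSpace X | StronglyFar δ E.1 Aᶜ}}

/-- `Σ(𝔅)`: the family of all finite unions of members of `𝔅`. -/
def SigmaFam {X : Type*} (B : Set (Set X)) : Set (Set X) :=
  {S | ∃ T : Finset (Set X), T.Nonempty ∧ ↑T ⊆ B ∧ S = ⋃₀ ↑T}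

namespace StronglyFar

variable {X : Type*} {δ : Set X → Set X → Prop}

theorem symm (P0 : ∀ A B : Set X, δ A B → δ B A) {A B : Set X}
    (h : StronglyFar δ A B) : StronglyFar δ B A := by
  obtain ⟨hAB, C, hAC, hCB⟩ := h
  exact ⟨fun h => hAB (P0 _ _ h), Cᶜ, by rw [compl_compl]; exact fun h => hCB (P0 _ _ h),
    fun h => hAC (P0 _ _ h)⟩

theorem empty_right (P1 : ∀ A B : Set X, δ A B → A ≠ ∅ ∧ B ≠ ∅) (A : Set X) :
    StronglyFar δ A ∅ :=
  ⟨fun h => (P1 _ _ h).2 rfl, Set.univ, by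
    rw [Set.compl_univ]; exact fun h => (P1 _ _ h).2 rfl, fun h => (P1 _ _ h).2 rfl⟩

theorem disjoint (P2 : ∀ A B : Set X, (A ∩ B) ≠ ∅ → δ A B) {A B : Set X}
    (h : StronglyFar δ A B) : Disjoint A B := by
  rw [Set.disjoint_iff_inter_eq_empty]
  by_contra hne
  exact h.1 (P2 _ _ hne)

theorem mono_right (P3 : ∀ A B C : Set X, δ A (B ∪ C) ↔ (δ A B ∨ δ A C)) {A B B' : Set X}
    (hB : B' ⊆ B) (h : StronglyFar δ A B) : StronglyFar δ A B' := by
  have mono : ∀ D, δ D B' → δ D B := fun D hD => by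
    rw [← Set.union_eq_self_of_subset_left hB]
    exact (P3 _ _ _).2 (Or.inl hD)
  obtain ⟨hAB, C, hAC, hCB⟩ := h
  exact ⟨fun h => hAB (mono _ h), C, hAC, fun h => hCB (mono _ h)⟩

theorem mono_left (P0 : ∀ A B : Set X, δ A B → δ B A)
    (P3 : ∀ A B C : Set X, δ A (B ∪ C) ↔ (δ A B ∨ δ A C)) {A A' B : Set X}
    (hA : A' ⊆ A) (h : StronglyFar δ A B) : StronglyFar δ A' B :=
  ((h.symm P0).mono_right P3 hA).symm P0

theorem union_right (P0 : ∀ A B : Set X, δ A B → δ B A)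
    (P3 : ∀ A B C : Set X, δ A (B ∪ C) ↔ (δ A B ∨ δ A C)) {A B B' : Set X}
    (h : StronglyFar δ A B) (h' : StronglyFar δ A B') : StronglyFar δ A (B ∪ B') := by
  obtain ⟨hAB, C, hAC, hCB⟩ := h
  obtain ⟨hAB', C', hAC', hCB'⟩ := h'
  have mono : ∀ {D E G : Set X}, D ⊆ E → δ D G → δ E G := fun {D E G} hDE hD => by
    rw [← Set.union_eq_self_of_subset_left hDE]
    exact P0 _ _ ((P3 _ _ _).2 (Or.inl (P0 _ _ hD)))
  refine ⟨by rw [P3]; tauto, C ∩ C', by rw [Set.compl_inter, P3]; tauto, ?_⟩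
  rw [P3]
  rintro (h | h)
  · exact hCB (mono Set.inter_subset_left h)
  · exact hCB' (mono Set.inter_subset_right h)

theorem union_left (P0 : ∀ A B : Set X, δ A B → δ B A)
    (P3 : ∀ A B C : Set X, δ A (B ∪ C) ↔ (δ A B ∨ δ A C)) {A A' B : Set X}
    (h : StronglyFar δ A B) (h' : StronglyFar δ A' B) : StronglyFar δ (A ∪ A') B :=
  ((h.symm P0).union_right P0 P3 (h'.symm P0)).symm P0

theorem closure_left [TopologicalSpace X] (P0 : ∀ A B : Set X, δ A B → δ B A)
    (P4 : ∀ A B C : Set X, δ A B → (∀ b ∈ B, δ {b} C) → δ A C)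
    (compatible : ∀ A : Set X, closure A = {x : X | δ {x} A}) {A B : Set X}
    (h : StronglyFar δ A B) : StronglyFar δ (closure A) B := by
  have near : ∀ {D : Set X}, δ (closure A) D → δ A D := fun {D} hD =>
    P0 _ _ (P4 D (closure A) A (P0 _ _ hD) fun b hb => by rwa [compatible] at hb)
  obtain ⟨hAB, C, hAC, hCB⟩ := h
  exact ⟨fun h => hAB (near h), C, fun h => hAC (near h), hCB⟩

end StronglyFar

section Hyperspace

variable {X : Type*} [TopologicalSpace X] {δ : Set X → Set X → Prop} {B : Set (Set X)}

/-- The union of a closed set with the closure of a point, as an element of `CL(X)`. -/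
def CLSpace.insertClosure (F : Set X) (hF : IsClosed F) (y : X) : CLSpace X :=
  ⟨F ∪ closure {y}, hF.union isClosed_closure, y, Or.inr (subset_closure rfl)⟩

theorem closure_singleton_inter_nonempty_iff {V : Set X} (hV : IsOpen V) (y : X) :
    (closure {y} ∩ V).Nonempty ↔ y ∈ V := by
  rw [closure_inter_open_nonempty_iff hV, Set.singleton_inter_nonempty]

theorem stronglyFar_insertClosure (P0 : ∀ A B : Set X, δ A B → δ B A)
    (P3 : ∀ A B C : Set X, δ A (B ∪ C) ↔ (δ A B ∨ δ A C))
    (P4 : ∀ A B C : Set X, δ A B → (∀ b ∈ B, δ {b} C) → δ A C)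
    (compatible : ∀ A : Set X, closure A = {x : X | δ {x} A})
    (hpoint : ∀ (F : Set X) (x : X), IsClosed F → x ∉ F → StronglyFar δ {x} F)
    {F A : Set X} (hF : IsClosed F) (hA : IsOpen A) (h : StronglyFar δ F Aᶜ) {y : X}
    (hy : y ∈ A) : StronglyFar δ (CLSpace.insertClosure F hF y).1 Aᶜ :=
  h.union_left P0 P3 <| (hpoint _ y hA.isClosed_compl (by simpa using hy)).closure_left
    P0 P4 compatible

theorem continuous_insertClosure (P0 : ∀ A B : Set X, δ A B → δ B A)
    (P2 : ∀ A B : Set X, (A ∩ B) ≠ ∅ → δ A B)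
    (P3 : ∀ A B C : Set X, δ A (B ∪ C) ↔ (δ A B ∨ δ A C))
    (P4 : ∀ A B C : Set X, δ A B → (∀ b ∈ B, δ {b} C) → δ A C)
    (compatible : ∀ A : Set X, closure A = {x : X | δ {x} A})
    (hpoint : ∀ (F : Set X) (x : X), IsClosed F → x ∉ F → StronglyFar δ {x} F)
    {F : Set X} (hF : IsClosed F) :
    @Continuous X (CLSpace X) _
      (TopologicalSpace.generateFrom (hitStronglyFarMissSubbase δ B))
      (CLSpace.insertClosure F hF) := by
  rw [continuous_generateFrom_iff]
  rintro s (⟨V, hV, rfl⟩ | ⟨A, hA, -, rfl⟩)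
  · have : CLSpace.insertClosure F hF ⁻¹' {E : CLSpace X | (E.1 ∩ V).Nonempty} =
        {_y | (F ∩ V).Nonempty} ∪ V := by
      ext y
      simp [CLSpace.insertClosure, Set.union_inter_distrib_right, Set.union_nonempty,
        closure_singleton_inter_nonempty_iff hV]
    rw [this]
    exact isOpen_const.union hV
  · have : CLSpace.insertClosure F hF ⁻¹' {E : CLSpace X | StronglyFar δ E.1 Aᶜ} =
        {_y | StronglyFar δ F Aᶜ} ∩ A := by
      ext y
      refine ⟨fun h => ⟨StronglyFar.mono_left P0 P3 Set.subset_union_left h, ?_⟩, fun h =>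
        stronglyFar_insertClosure P0 P3 P4 compatible hpoint hF hA h.1 h.2⟩
      have hdisj := StronglyFar.disjoint P2 h
      exact Set.disjoint_compl_right_iff_subset.1 hdisj (Or.inr (subset_closure rfl))
    rw [this]
    exact isOpen_const.inter hA

theorem exists_finset_insertClosure_mem (P0 : ∀ A B : Set X, δ A B → δ B A)
    (P1 : ∀ A B : Set X, δ A B → A ≠ ∅ ∧ B ≠ ∅)
    (P3 : ∀ A B C : Set X, δ A (B ∪ C) ↔ (δ A B ∨ δ A C))
    (P4 : ∀ A B C : Set X, δ A B → (∀ b ∈ B, δ {b} C) → δ A C)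
    (compatible : ∀ A : Set X, closure A = {x : X | δ {x} A})
    (hpoint : ∀ (F : Set X) (x : X), IsClosed F → x ∉ F → StronglyFar δ {x} F)
    (F : CLSpace X) {O : Set (CLSpace X)}
    (hO : TopologicalSpace.GenerateOpen (hitStronglyFarMissSubbase δ B) O) (hFO : F ∈ O) :
    ∃ T : Finset (Set X), ↑T ⊆ B ∧ StronglyFar δ F.1 (⋃₀ ↑T) ∧
      ∀ y ∉ ⋃₀ (T : Set (Set X)), CLSpace.insertClosure F.1 F.2.1 y ∈ O := by
  classical
  induction hO with
  | basic s hs =>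
    rcases hs with ⟨V, hV, rfl⟩ | ⟨A, hA, hAB, rfl⟩
    · refine ⟨∅, by simp, by simpa using StronglyFar.empty_right P1 _, fun y _ => ?_⟩
      exact Set.Nonempty.mono (Set.inter_subset_inter_left _ Set.subset_union_left) hFO
    · refine ⟨{Aᶜ}, by simpa using hAB, by simpa using hFO, fun y hy => ?_⟩
      exact stronglyFar_insertClosure P0 P3 P4 compatible hpoint F.2.1 hA hFO (by simpa using hy)
  | univ => exact ⟨∅, by simp, by simpa using StronglyFar.empty_right P1 _, fun y _ => trivial⟩
  | inter s t _ _ ihs iht =>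
    obtain ⟨T, hTB, hT, hTs⟩ := ihs hFO.1
    obtain ⟨T', hTB', hT', hTt⟩ := iht hFO.2
    refine ⟨T ∪ T', by simp [hTB, hTB'], ?_, fun y hy => ?_⟩
    · rw [Finset.coe_union, Set.sUnion_union]
      exact hT.union_right P0 P3 hT'
    · rw [Finset.coe_union, Set.sUnion_union, Set.mem_union, not_or] at hy
      exact ⟨hTs y hy.1, hTt y hy.2⟩
  | sUnion S _ ih =>
    obtain ⟨s, hs, hFs⟩ := hFO
    obtain ⟨T, hTB, hT, hTs⟩ := ih s hs hFs
    exact ⟨T, hTB, hT, fun y hy => ⟨s, hs, hTs y hy⟩⟩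

theorem exists_mem_sigmaFam_of_t2 (P0 : ∀ A B : Set X, δ A B → δ B A)
    (P1 : ∀ A B : Set X, δ A B → A ≠ ∅ ∧ B ≠ ∅)
    (P2 : ∀ A B : Set X, (A ∩ B) ≠ ∅ → δ A B)
    (P3 : ∀ A B C : Set X, δ A (B ∪ C) ↔ (δ A B ∨ δ A C))
    (P4 : ∀ A B C : Set X, δ A B → (∀ b ∈ B, δ {b} C) → δ A C)
    (compatible : ∀ A : Set X, closure A = {x : X | δ {x} A})
    (hpoint : ∀ (F : Set X) (x : X), IsClosed F → x ∉ F → StronglyFar δ {x} F)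
    (h2 : @T2Space (CLSpace X)
      (TopologicalSpace.generateFrom (hitStronglyFarMissSubbase δ B)))
    {x : X} {F : Set X} (hF : IsClosed F) (hne : F.Nonempty) (hx : x ∉ F) :
    ∃ S ∈ SigmaFam B, x ∈ interior S ∧ StronglyFar δ S F := by
  let τ := TopologicalSpace.generateFrom (hitStronglyFarMissSubbase δ B)
  have hcont : Continuous (CLSpace.insertClosure F hF) :=
    continuous_insertClosure P0 P2 P3 P4 compatible hpoint hF
  have hFx : CLSpace.insertClosure F hF x ≠ ⟨F, hF, hne⟩ := fun h =>
    hx ((congrArg Subtype.val h).subset (Or.inr (subset_closure rfl)))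
  obtain ⟨O₁, O₂, hO₁, hO₂, hx₁, hF₂, hdisj⟩ := t2_separation hFx
  obtain ⟨T, hTB, hT, hTO⟩ := exists_finset_insertClosure_mem P0 P1 P3 P4 compatible hpoint
    ⟨F, hF, hne⟩ hO₂ hF₂
  have hsub : CLSpace.insertClosure F hF ⁻¹' O₁ ⊆ ⋃₀ ↑T := fun y hy => by
    by_contra hyT
    exact Set.disjoint_left.1 hdisj hy (hTO y hyT)
  refine ⟨⋃₀ ↑T, ⟨T, ?_, hTB, rfl⟩, mem_interior.2 ⟨_, hsub, hO₁.preimage hcont, hx₁⟩,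
    hT.symm P0⟩
  obtain ⟨s, hs, -⟩ := hsub hx₁
  exact ⟨s, hs⟩

theorem isOpen_forall_stronglyFar (hBcl : ∀ S ∈ B, IsClosed S ∧ S.Nonempty)
    (T : Finset (Set X)) (hT : ↑T ⊆ B) :
    @IsOpen _ (TopologicalSpace.generateFrom (hitStronglyFarMissSubbase δ B))
      (⋂ S ∈ T, {E : CLSpace X | StronglyFar δ E.1 S}) := by
  let τ := TopologicalSpace.generateFrom (hitStronglyFarMissSubbase δ B)
  refine isOpen_biInter_finset fun S hS => ?_
  refine TopologicalSpace.isOpen_generateFrom_of_mem (Or.inr ⟨Sᶜ, ?_, ?_, ?_⟩)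
  · exact (hBcl S (hT hS)).1.isOpen_compl
  · simpa using hT hS
  · rw [compl_compl]

theorem separatedNhds_of_mem_of_notMem (P0 : ∀ A B : Set X, δ A B → δ B A)
    (P2 : ∀ A B : Set X, (A ∩ B) ≠ ∅ → δ A B)
    (P3 : ∀ A B C : Set X, δ A (B ∪ C) ↔ (δ A B ∨ δ A C))
    (hBcl : ∀ S ∈ B, IsClosed S ∧ S.Nonempty)
    (hloc : ∀ (x : X) (U : Set X), IsOpen U → x ∈ U →
      ∃ S ∈ SigmaFam B, x ∈ interior S ∧ StronglyFar δ S Uᶜ)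
    {E F : CLSpace X} {x : X} (hxE : x ∈ E.1) (hxF : x ∉ F.1) :
    @SeparatedNhds _ (TopologicalSpace.generateFrom (hitStronglyFarMissSubbase δ B))
      {E} {F} := by
  let τ := TopologicalSpace.generateFrom (hitStronglyFarMissSubbase δ B)
  obtain ⟨_, ⟨T, -, hTB, rfl⟩, hx, hfar⟩ := hloc x F.1ᶜ F.2.1.isOpen_compl hxF
  rw [compl_compl] at hfar
  refine ⟨{G | (G.1 ∩ interior (⋃₀ ↑T)).Nonempty}, ⋂ S ∈ T, {G | StronglyFar δ G.1 S},
    TopologicalSpace.isOpen_generateFrom_of_mem (Or.inl ⟨_, isOpen_interior, rfl⟩),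
    isOpen_forall_stronglyFar hBcl T hTB, ?_, ?_, ?_⟩
  · exact Set.singleton_subset_iff.2 ⟨x, hxE, hx⟩
  · rw [Set.singleton_subset_iff]
    exact Set.mem_iInter₂.2 fun S hS =>
      (hfar.symm P0).mono_right P3 (Set.subset_sUnion_of_mem hS)
  · rw [Set.disjoint_left]
    rintro G ⟨y, hyG, hy⟩ hG
    obtain ⟨S, hS, hyS⟩ := interior_subset hy
    exact Set.disjoint_left.1 (StronglyFar.disjoint P2 (Set.mem_iInter₂.1 hG S hS)) hyG hyS

end Hyperspace


/-- with `δ` a compatible Lodato proximity such that every point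
outside a closed set is strongly far from it, and `𝔅` a nonempty family of
nonempty closed sets, `(CL(X), τ⩔,𝔅)` is `T₂` iff `Σ(𝔅)` is a strongly
local family. -/
theorem hitStronglyFarMiss_t2_iff {X : Type*} [TopologicalSpace X]
    (δ : Set X → Set X → Prop)
    (P0 : ∀ A B : Set X, δ A B → δ B A)
    (P1 : ∀ A B : Set X, δ A B → A ≠ ∅ ∧ B ≠ ∅)
    (P2 : ∀ A B : Set X, (A ∩ B) ≠ ∅ → δ A B)
    (P3 : ∀ A B C : Set X, δ A (B ∪ C) ↔ (δ A B ∨ δ A C))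
    (P4 : ∀ A B C : Set X, δ A B → (∀ b ∈ B, δ {b} C) → δ A C)
    (compatible : ∀ A : Set X, closure A = {x : X | δ {x} A})
    (hpoint : ∀ (F : Set X) (x : X), IsClosed F → x ∉ F → StronglyFar δ {x} F)
    (B : Set (Set X)) (hBne : B.Nonempty)
    (hBcl : ∀ S ∈ B, IsClosed S ∧ S.Nonempty) :
    @T2Space (CLSpace X)
        (TopologicalSpace.generateFrom (hitStronglyFarMissSubbase δ B)) ↔
      (∀ (x : X) (U : Set X), IsOpen U → x ∈ U →
        ∃ S ∈ SigmaFam B, x ∈ interior S ∧ StronglyFar δ S Uᶜ) := by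
  constructor
  · intro h2 x U hU hxU
    have main {F : Set X} (hF : IsClosed F) (hne : F.Nonempty) (hx : x ∉ F) :=
      exists_mem_sigmaFam_of_t2 P0 P1 P2 P3 P4 compatible hpoint h2 hF hne hx
    rcases Uᶜ.eq_empty_or_nonempty with hUe | hUne
    · rw [hUe]
      suffices ∃ S ∈ SigmaFam B, x ∈ interior S by
        obtain ⟨S, hS, hxS⟩ := this
        exact ⟨S, hS, hxS, StronglyFar.empty_right P1 S⟩
      obtain ⟨S₀, hS₀⟩ := hBne
      obtain ⟨hcl, hne⟩ := hBcl S₀ hS₀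
      by_cases hxS : x ∈ S₀
      · by_cases huniv : S₀ = Set.univ
        · exact ⟨S₀, ⟨{S₀}, by simp, by simpa using hS₀, by simp⟩, by simp [huniv]⟩
        · obtain ⟨y, hy⟩ := (Set.ne_univ_iff_exists_notMem _).1 huniv
          have hxy : x ∉ closure {y} := fun hxy => by
            have hyx : y ∈ closure {x} := by
              rw [compatible] at hxy ⊢
              exact P0 _ _ hxy
            exact hy (closure_minimal (Set.singleton_subset_iff.2 hxS) hcl hyx)
          obtain ⟨S, hS, hxS, -⟩ := main isClosed_closure
            ⟨y, subset_closure (Set.mem_singleton y)⟩ hxy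
          exact ⟨S, hS, hxS⟩
      · obtain ⟨S, hS, hxS, -⟩ := main hcl hne hxS
        exact ⟨S, hS, hxS⟩
    · exact main hU.isClosed_compl hUne (by simpa using hxU)
  · intro hloc
    let τ := TopologicalSpace.generateFrom (hitStronglyFarMissSubbase δ B)
    have sep {E F : CLSpace X} (h : ¬ E.1 ⊆ F.1) : SeparatedNhds {E} {F} := by
      obtain ⟨x, hxE, hxF⟩ := Set.not_subset.1 h
      exact separatedNhds_of_mem_of_notMem P0 P2 P3 hBcl hloc hxE hxF
    refine t2Space_iff_disjoint_nhds.2 fun E F hEF => ?_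
    beta_reduce
    rw [← nhdsSet_singleton, ← nhdsSet_singleton, ← separatedNhds_iff_disjoint]
    by_cases h : E.1 ⊆ F.1
    · exact (sep fun h' => hEF (Subtype.ext (h.antisymm h'))).symm
    · exact sep h
end

section
/- Let (X, τ) be a regular topological space, let δ be a Lodato proximity on X compatible with τ, let δ⩕ be a strongly near proximity on X, and let 𝔅 be a nonempty family of nonempty regular closed subsets of X. Equip RCL(X) with the strongly hit and far-miss topology τ⩕,𝔅 generated by the subbase consisting of all sets V⩕ = {E ∈ RCL(X) : E δ⩕ V} with V regular open in X, together with all sets A⁺⁺ = {E ∈ RCL(X) : ¬(E δ (X \ A))} with A regular open in X and X \ A ∈ 𝔅. If Σ(𝔅) is a regular local family, i.e., for every x ∈ X and every regular open set U containing x there exists S ∈ Σ(𝔅) with x ∈ interior(S) and ¬(S δ (X \ U)), then (RCL(X), τ⩕,𝔅) is Hausdorff (T2). -/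
/-- `RCL(X)`: the nonempty regular closed subsets of `X`. -/
def RCLSpace (X : Type*) [TopologicalSpace X] : Type _ :=
  {E : Set X // E.Nonempty ∧ E = closure (interior E)}

/-- The subbase of the strongly hit and far-miss topology `τ⩕,𝔅` on `RCL(X)`:
strong hit sets `V⩕` for `V` regular open, and miss sets `A⁺⁺` for `A`
regular open with `X \ A ∈ 𝔅`. -/
def stronglyHitFarMissSubbase {X : Type*} [TopologicalSpace X]
    (δ : Set X → Set X → Prop) (sn : Set X → Set X → Prop)
    (B : Set (Set X)) : Set (Set (RCLSpace X)) :=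
  {s | ∃ V : Set X, V = interior (closure V) ∧ s = {E : RCLSpace X | sn E.1 V}} ∪
  {s | ∃ A : Set X, A = interior (closure A) ∧ Aᶜ ∈ B ∧
        s = {E : RCLSpace X | ¬ δ E.1 Aᶜ}}

theorem compl_eq_interior_closure_of_regularClosed {X : Type*} [TopologicalSpace X] {F : Set X}
    (hF : F = closure (interior F)) : Fᶜ = interior (closure Fᶜ) := by
  rw [closure_compl, interior_compl, ← hF]

theorem interior_eq_interior_closure_of_regularClosed {X : Type*} [TopologicalSpace X]
    {F : Set X} (hF : F = closure (interior F)) :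
    interior F = interior (closure (interior F)) := by
  rw [← hF]

/-- If `E` is not contained in `F`, a single member `S` of `B` separates them: `E` strongly hits
the interior of `S`, while `F` is far from `S`. -/
theorem exists_hit_far_miss_of_not_subset {X : Type*} [TopologicalSpace X]
    {δ : Set X → Set X → Prop}
    (δ_symm : ∀ A B : Set X, δ A B → δ B A)
    (δ_union : ∀ A B C : Set X, δ A (B ∪ C) ↔ (δ A B ∨ δ A C))
    {sn : Set X → Set X → Prop}
    (sn_of_interior : ∀ A B : Set X, (interior A ∩ interior B) ≠ ∅ → sn A B)
    {B : Set (Set X)} (hB : ∀ S ∈ B, S = closure (interior S))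
    (hloc : ∀ (x : X) (U : Set X), U = interior (closure U) → x ∈ U →
      ∃ S ∈ SigmaFam B, x ∈ interior S ∧ ¬ δ S Uᶜ)
    {E F : Set X} (hE : E = closure (interior E)) (hF : F = closure (interior F))
    (hEF : ¬ E ⊆ F) :
    ∃ S ∈ B, sn E (interior S) ∧ ¬ δ F S := by
  have hF_closed : IsClosed F := hF ▸ isClosed_closure
  obtain ⟨x, hxE, hxF⟩ : ∃ x ∈ interior E, x ∉ F := by
    by_contra! h
    exact hEF (hE ▸ closure_minimal h hF_closed)
  obtain ⟨_, ⟨T, -, hTB, rfl⟩, hxT, hfar⟩ :=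
    hloc x Fᶜ (compl_eq_interior_closure_of_regularClosed hF) hxF
  obtain ⟨S, hST, hxS⟩ := interior_subset hxT
  refine ⟨S, hTB hST, sn_of_interior _ _ ?_, fun h => hfar ?_⟩
  · rw [interior_interior]
    rw [hB S (hTB hST)] at hxS
    exact (mem_closure_iff.1 hxS _ isOpen_interior hxE).ne_empty
  · rw [compl_compl, ← Set.union_eq_self_of_subset_left (Set.subset_sUnion_of_mem hST)]
    exact δ_symm _ _ ((δ_union _ _ _).2 (Or.inl h))

/-- on a regular space `X`, with `δ` a compatible Lodato proximity,
`sn` a strongly near proximity, and `𝔅` a nonempty family of nonempty regular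
closed sets, if `Σ(𝔅)` is a regular local family then `(RCL(X), τ⩕,𝔅)`
is `T₂`. -/
theorem stronglyHitFarMiss_t2 {X : Type*} [TopologicalSpace X] [RegularSpace X]
    (δ : Set X → Set X → Prop)
    (P0 : ∀ A B : Set X, δ A B → δ B A)
    (P1 : ∀ A B : Set X, δ A B → A ≠ ∅ ∧ B ≠ ∅)
    (P2 : ∀ A B : Set X, (A ∩ B) ≠ ∅ → δ A B)
    (P3 : ∀ A B C : Set X, δ A (B ∪ C) ↔ (δ A B ∨ δ A C))
    (P4 : ∀ A B C : Set X, δ A B → (∀ b ∈ B, δ {b} C) → δ A C)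
    (compatible : ∀ A : Set X, closure A = {x : X | δ {x} A})
    (sn : Set X → Set X → Prop)
    (N0 : ∀ A : Set X, ¬ sn ∅ A)
    (N1 : ∀ A B : Set X, sn A B ↔ sn B A)
    (N2 : ∀ A B : Set X, sn A B → (A ∩ B) ≠ ∅)
    (N3 : ∀ A B C : Set X, interior B ≠ ∅ → interior C ≠ ∅ →
      (sn A B ∨ sn A C) → sn A (B ∪ C))
    (N4 : ∀ A B : Set X, (interior A ∩ interior B) ≠ ∅ → sn A B)
    (B : Set (Set X)) (hBne : B.Nonempty)
    (hBrc : ∀ S ∈ B, S.Nonempty ∧ S = closure (interior S))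
    (hloc : ∀ (x : X) (U : Set X), U = interior (closure U) → x ∈ U →
      ∃ S ∈ SigmaFam B, x ∈ interior S ∧ ¬ δ S Uᶜ) :
    @T2Space (RCLSpace X)
      (TopologicalSpace.generateFrom (stronglyHitFarMissSubbase δ sn B)) := by
  have separate : ∀ E F : RCLSpace X, ¬ E.1 ⊆ F.1 →
      ∃ u ∈ stronglyHitFarMissSubbase δ sn B, ∃ v ∈ stronglyHitFarMissSubbase δ sn B,
        E ∈ u ∧ F ∈ v ∧ Disjoint u v := by
    intro E F hEF
    obtain ⟨S, hSB, hit, miss⟩ := exists_hit_far_miss_of_not_subset P0 P3 N4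
      (fun S hS => (hBrc S hS).2) hloc E.2.2 F.2.2 hEF
    have hS := (hBrc S hSB).2
    refine ⟨{G | sn G.1 (interior S)},
      Or.inl ⟨_, interior_eq_interior_closure_of_regularClosed hS, rfl⟩,
      {G | ¬ δ G.1 S},
      Or.inr ⟨Sᶜ, compl_eq_interior_closure_of_regularClosed hS, ?_, ?_⟩, hit, miss, ?_⟩
    · rwa [compl_compl]
    · rw [compl_compl]
    · refine Set.disjoint_left.2 fun G hG hG' => hG' (P2 _ _ ?_)
      exact ((Set.nonempty_iff_ne_empty.2 (N2 _ _ hG)).mono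
        (Set.inter_subset_inter_right _ interior_subset)).ne_empty
  let _ : TopologicalSpace (RCLSpace X) :=
    TopologicalSpace.generateFrom (stronglyHitFarMissSubbase δ sn B)
  refine ⟨fun E F hne => ?_⟩
  by_cases hEF : E.1 ⊆ F.1
  · have hFE : ¬ F.1 ⊆ E.1 := fun h => hne (Subtype.ext (hEF.antisymm h))
    obtain ⟨u, hu, v, hv, hFu, hEv, huv⟩ := separate F E hFE
    exact ⟨v, u, .basic v hv, .basic u hu, hEv, hFu, huv.symm⟩
  · obtain ⟨u, hu, v, hv, hEu, hFv, huv⟩ := separate E F hEF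
    exact ⟨u, v, .basic u hu, .basic v hv, hEu, hFv, huv⟩
end

section
/- Let X be a T1 topological space and define the Alexandroff relation δ_A on subsets of X by: A δ_A B iff closure(A) ∩ closure(B) ≠ ∅, or both closure(A) and closure(B) are non-compact. Then δ_A is a Lodato proximity on X (it satisfies P0–P4) and it is compatible with the topology of X: for every A ⊆ X, closure(A) = {x ∈ X : {x} δ_A A}. -/
/-- The Alexandroff relation: `A δ_A B` iff the closures of `A` and `B` meet,
or both closures are non-compact. -/
def alexandroffProx {X : Type*} [TopologicalSpace X] (A B : Set X) : Prop :=
  (closure A ∩ closure B) ≠ ∅ ∨ (¬ IsCompact (closure A) ∧ ¬ IsCompact (closure B))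

theorem alexandroffProx_iff {X : Type*} [TopologicalSpace X] {A B : Set X} :
    alexandroffProx A B ↔ (closure A ∩ closure B).Nonempty ∨
      (¬ IsCompact (closure A) ∧ ¬ IsCompact (closure B)) := by
  rw [alexandroffProx, Set.nonempty_iff_ne_empty]

theorem alexandroffProx_comm {X : Type*} [TopologicalSpace X] {A B : Set X} :
    alexandroffProx A B ↔ alexandroffProx B A := by
  rw [alexandroffProx, alexandroffProx, Set.inter_comm, and_comm]

theorem not_alexandroffProx_empty_left {X : Type*} [TopologicalSpace X] (B : Set X) :
    ¬ alexandroffProx ∅ B := by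
  simp [alexandroffProx]

theorem alexandroffProx_mono_right {X : Type*} [TopologicalSpace X] {A B C : Set X}
    (hBC : closure B ⊆ closure C) (h : alexandroffProx A B) : alexandroffProx A C := by
  rw [alexandroffProx_iff] at h ⊢
  exact h.imp (fun h => h.mono (Set.inter_subset_inter_right _ hBC))
    (fun h => ⟨h.1, fun hC => h.2 (hC.of_isClosed_subset isClosed_closure hBC)⟩)

theorem alexandroffProx_union_right {X : Type*} [TopologicalSpace X] {A B C : Set X} :
    alexandroffProx A (B ∪ C) ↔ alexandroffProx A B ∨ alexandroffProx A C := by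
  constructor
  · simp only [alexandroffProx_iff, closure_union, Set.inter_union_distrib_left,
      Set.union_nonempty]
    have := IsCompact.union (s := closure B) (t := closure C)
    tauto
  · rintro (h | h)
    · exact alexandroffProx_mono_right (closure_mono Set.subset_union_left) h
    · exact alexandroffProx_mono_right (closure_mono Set.subset_union_right) h

theorem alexandroffProx_singleton_left {X : Type*} [TopologicalSpace X] [T1Space X]
    {x : X} {A : Set X} : alexandroffProx {x} A ↔ x ∈ closure A := by
  simp [alexandroffProx_iff]

/-- on a `T₁` space, the Alexandroff relation is a Lodato proximity
(P0–P4) compatible with the topology. -/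
theorem alexandroffProx_lodato {X : Type*} [TopologicalSpace X] [T1Space X] :
    (∀ A B : Set X, alexandroffProx A B → alexandroffProx B A) ∧
    (∀ A B : Set X, alexandroffProx A B → A ≠ ∅ ∧ B ≠ ∅) ∧
    (∀ A B : Set X, (A ∩ B) ≠ ∅ → alexandroffProx A B) ∧
    (∀ A B C : Set X,
      alexandroffProx A (B ∪ C) ↔ (alexandroffProx A B ∨ alexandroffProx A C)) ∧
    (∀ A B C : Set X, alexandroffProx A B → (∀ b ∈ B, alexandroffProx {b} C) →
      alexandroffProx A C) ∧
    (∀ A : Set X, closure A = {x : X | alexandroffProx {x} A}) := by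
  refine ⟨fun _ _ => alexandroffProx_comm.1, fun A B h => ⟨?_, ?_⟩, fun A B h => Or.inl ?_,
    fun _ _ _ => alexandroffProx_union_right, fun A B C h hBC => ?_, fun A => ?_⟩
  · rintro rfl
    exact not_alexandroffProx_empty_left B h
  · rintro rfl
    exact not_alexandroffProx_empty_left A (alexandroffProx_comm.1 h)
  · rw [← Set.nonempty_iff_ne_empty] at h ⊢
    exact h.mono (Set.inter_subset_inter subset_closure subset_closure)
  · exact alexandroffProx_mono_right (closure_minimal
      (fun b hb => alexandroffProx_singleton_left.1 (hBC b hb)) isClosed_closure) h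
  · ext x
    exact alexandroffProx_singleton_left.symm
end

section
/- Let X be a locally compact Hausdorff topological space, and let δ_A be the Alexandroff proximity on X: A δ_A B iff closure(A) ∩ closure(B) ≠ ∅, or both closure(A) and closure(B) are non-compact. Then the family of compact subsets of X is a strongly local family: for every x ∈ X and every open set U containing x, there exists a compact set S ⊆ X with x ∈ interior(S) and S strongly far from X \ U with respect to δ_A. -/
theorem not_alexandroffProx_compl {X : Type*} [TopologicalSpace X] [T2Space X]
    {K U : Set X} (hK : IsCompact K) (h : K ⊆ interior U) :
    ¬ alexandroffProx K Uᶜ := by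
  rintro (hne | ⟨hnc, -⟩)
  · apply hne
    rw [hK.isClosed.closure_eq, closure_compl]
    exact (Set.disjoint_compl_right_iff_subset.mpr h).inter_eq
  · exact hnc (by rwa [hK.isClosed.closure_eq])

/-- in a locally compact Hausdorff space, the family of compact
subsets is a strongly local family with respect to the Alexandroff proximity. -/
theorem compact_stronglyLocalFamily {X : Type*} [TopologicalSpace X]
    [LocallyCompactSpace X] [T2Space X] :
    ∀ (x : X) (U : Set X), IsOpen U → x ∈ U →
      ∃ S : Set X, IsCompact S ∧ x ∈ interior S ∧
        StronglyFar (alexandroffProx (X := X)) S Uᶜ := by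
  intro x U hU hx
  obtain ⟨K, hK, hxK, hKU⟩ := exists_compact_subset hU hx
  obtain ⟨L, hL, hKL, hLU⟩ := exists_compact_between hK hU hKU
  have hUi : interior U = U := hU.interior_eq
  exact ⟨K, hK, hxK, not_alexandroffProx_compl hK (hUi.symm ▸ hKU), L,
    not_alexandroffProx_compl hK hKL, not_alexandroffProx_compl hL (hUi.symm ▸ hLU)⟩
end
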